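/- Let a, b, c ∈ ℂ with c ∉ ℤ and c − a − b ∉ ℤ. Then on (0,1) the connection formula F(a,b;c;ξ) = (Γ(c)Γ(c−a−b)/(Γ(c−a)Γ(c−b))) F(a,b;a+b−c+1;1−ξ) + (Γ(c)Γ(a+b−c)/(Γ(a)Γ(b))) (1−ξ)^{c−a−b} F(c−a,c−b;c−a−b+1;1−ξ) holds. -/

import Mathlib

open scoped Nat

/-- The Gauss hypergeometric series `F(a,b;c;x)`. -/
noncomputable def hypF (a b c : ℂ) (x : ℂ) : ℂ :=
  ∑' n : ℕ, (ascPochhammer ℂ n).eval a * (ascPochhammer ℂ n).eval b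
      / ((ascPochhammer ℂ n).eval c * (n ! : ℂ)) * x ^ n

namespace HypConn

open Filter Topology Complex

/-- Pochhammer symbol. -/
noncomputable def poch (a : ℂ) (n : ℕ) : ℂ := (ascPochhammer ℂ n).eval a

lemma poch_zero (a : ℂ) : poch a 0 = 1 := by simp [poch]

lemma poch_succ (a : ℂ) (n : ℕ) : poch a (n + 1) = poch a n * (a + n) :=
  ascPochhammer_succ_eval n a

lemma poch_succ_left (a : ℂ) (n : ℕ) : poch a (n + 1) = a * poch (a + 1) n := by
  simp [poch, ascPochhammer_succ_left]

lemma poch_eq_prod (a : ℂ) (n : ℕ) : poch a n = ∏ j ∈ Finset.range n, (a + j) := by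
  induction n with
  | zero => simp [poch_zero]
  | succ n ih => rw [poch_succ, ih, Finset.prod_range_succ]

lemma poch_ne_zero {a : ℂ} (h : ∀ k : ℕ, a + k ≠ 0) (n : ℕ) : poch a n ≠ 0 := by
  rw [poch_eq_prod]
  exact Finset.prod_ne_zero_iff.mpr fun j _ => h j

/-- Hypergeometric coefficient. -/
noncomputable def coef (a b c : ℂ) (n : ℕ) : ℂ :=
  poch a n * poch b n / (poch c n * (n ! : ℂ))

/-- Power series sum. -/
noncomputable def S (p : ℕ → ℂ) (x : ℂ) : ℂ := ∑' n, p n * x ^ n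

lemma hypF_eq (a b c x : ℂ) : hypF a b c x = S (coef a b c) x := rfl

/-- Polynomially bounded sequences. -/
def Good (p : ℕ → ℂ) : Prop := ∃ C : ℝ, ∃ k : ℕ, ∀ n : ℕ, ‖p n‖ ≤ C * ((n : ℝ) + 1) ^ k

lemma summable_aux (k : ℕ) {r : ℝ} (h0 : 0 ≤ r) (h1 : r < 1) :
    Summable fun n : ℕ => ((n : ℝ) + 1) ^ k * r ^ n := by
  rcases h0.eq_or_lt with rfl | h0
  · apply summable_of_ne_finset_zero (s := {0})
    intro n hn
    have : n ≠ 0 := by simpa using hn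
    simp [this]
  have := (summable_nat_add_iff (f := fun n : ℕ => (n : ℝ) ^ k * r ^ n) 1).2
    (summable_pow_mul_geometric_of_norm_lt_one k (by rwa [Real.norm_of_nonneg h0.le]))
  refine (this.mul_left r⁻¹).congr fun n => ?_
  push_cast
  rw [pow_succ]
  field_simp

lemma Good.summable_norm {p : ℕ → ℂ} (hp : Good p) {r : ℝ} (h0 : 0 ≤ r) (h1 : r < 1) :
    Summable fun n => ‖p n‖ * r ^ n := by
  obtain ⟨C, k, h⟩ := hp
  refine Summable.of_nonneg_of_le (fun n => by positivity) (fun n => ?_)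
    ((summable_aux k h0 h1).mul_left C)
  rw [← mul_assoc]
  exact mul_le_mul_of_nonneg_right (h n) (by positivity)

lemma Good.summable {p : ℕ → ℂ} (hp : Good p) {x : ℂ} (h1 : ‖x‖ < 1) :
    Summable fun n => p n * x ^ n := by
  apply Summable.of_norm
  simpa using hp.summable_norm (norm_nonneg x) h1

lemma Good.add {p q : ℕ → ℂ} (hp : Good p) (hq : Good q) : Good (fun n => p n + q n) := by
  obtain ⟨C, k, h⟩ := hp
  obtain ⟨D, l, h'⟩ := hq
  have hC : 0 ≤ C := by have := h 0; simp at this; exact (norm_nonneg _).trans this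
  have hD : 0 ≤ D := by have := h' 0; simp at this; exact (norm_nonneg _).trans this
  refine ⟨C + D, k + l, fun n => (norm_add_le _ _).trans ?_⟩
  have h1 : (1 : ℝ) ≤ (n : ℝ) + 1 := by linarith [n.cast_nonneg (α := ℝ)]
  rw [add_mul]
  gcongr
  · exact (h n).trans (by gcongr; omega)
  · exact (h' n).trans (by gcongr; omega)

lemma Good.cmul {p : ℕ → ℂ} (hp : Good p) (c : ℂ) : Good (fun n => c * p n) := by
  obtain ⟨C, k, h⟩ := hp
  refine ⟨‖c‖ * C, k, fun n => ?_⟩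
  rw [norm_mul, mul_assoc]
  exact mul_le_mul_of_nonneg_left (h n) (norm_nonneg _)

/-- multiplication by x -/
def shift (p : ℕ → ℂ) : ℕ → ℂ
  | 0 => 0
  | n + 1 => p n

lemma shift_succ (p : ℕ → ℂ) (n : ℕ) : shift p (n + 1) = p n := rfl

/-- derivative -/
def dd (p : ℕ → ℂ) : ℕ → ℂ := fun n => ((n : ℂ) + 1) * p (n + 1)

lemma Good.shift {p : ℕ → ℂ} (hp : Good p) : Good (shift p) := by
  obtain ⟨C, k, h⟩ := hp
  have hC : 0 ≤ C := by have := h 0; simp at this; exact (norm_nonneg _).trans this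
  refine ⟨C, k, fun n => ?_⟩
  cases n with
  | zero => simp [HypConn.shift, hC]
  | succ n =>
    refine (h n).trans ?_
    gcongr
    linarith

lemma Good.dd {p : ℕ → ℂ} (hp : Good p) : Good (dd p) := by
  obtain ⟨C, k, h⟩ := hp
  have hC : 0 ≤ C := by have := h 0; simp at this; exact (norm_nonneg _).trans this
  refine ⟨C * 2 ^ k, k + 1, fun n => ?_⟩
  have e : ‖(n : ℂ) + 1‖ = (n : ℝ) + 1 := by
    have : ((n : ℂ) + 1) = ((n + 1 : ℕ) : ℂ) := by push_cast; ring
    rw [this, Complex.norm_natCast]; push_cast; ring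
  unfold HypConn.dd
  rw [norm_mul, e]
  have h2 : ‖p (n + 1)‖ ≤ C * (2 * ((n : ℝ) + 1)) ^ k := by
    refine (h (n + 1)).trans ?_
    gcongr
    push_cast
    linarith [n.cast_nonneg (α := ℝ)]
  calc ((n : ℝ) + 1) * ‖p (n + 1)‖ ≤ ((n : ℝ) + 1) * (C * (2 * ((n : ℝ) + 1)) ^ k) := by gcongr
    _ = _ := by rw [mul_pow]; ring

lemma S_add {p q : ℕ → ℂ} (hp : Good p) (hq : Good q) {x : ℂ} (h1 : ‖x‖ < 1) :
    S (fun n => p n + q n) x = S p x + S q x := by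
  unfold S
  rw [← (hp.summable h1).tsum_add (hq.summable h1)]
  simp only [add_mul]

lemma S_cmul (p : ℕ → ℂ) (c x : ℂ) : S (fun n => c * p n) x = c * S p x := by
  unfold S
  rw [← tsum_mul_left]
  simp only [mul_assoc]

lemma S_shift {p : ℕ → ℂ} (hp : Good p) {x : ℂ} (h1 : ‖x‖ < 1) :
    S (shift p) x = x * S p x := by
  unfold S
  rw [(hp.shift.summable h1).tsum_eq_zero_add, ← tsum_mul_left]
  simp only [shift, zero_mul, zero_add]
  congr 1; ext n; ring

lemma S_zero (p : ℕ → ℂ) : S p 0 = p 0 := by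
  unfold S
  rw [tsum_eq_single 0]
  · simp
  · intro n hn; simp [hn]

lemma hasDerivAt_S {p : ℕ → ℂ} (hp : Good p) {x : ℂ} (h1 : ‖x‖ < 1) :
    HasDerivAt (S p) (S (dd p) x) x := by
  obtain ⟨r, hr1, hr2⟩ := exists_between h1
  have hr0 : 0 ≤ r := (norm_nonneg x).trans hr1.le
  have hs : Summable fun n : ℕ => ‖(n : ℂ) * p n‖ * r ^ (n - 1) := by
    rw [← summable_nat_add_iff 1]
    refine (hp.dd.summable_norm hr0 hr2).congr fun n => ?_
    simp [dd]
  have key := hasDerivAt_tsum_of_isPreconnected (g := fun n z => p n * z ^ n)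
    (g' := fun n z => p n * (n * z ^ (n - 1))) (t := Metric.ball (0 : ℂ) r) (y₀ := 0) (y := x) hs
    Metric.isOpen_ball (convex_ball _ _).isPreconnected
    (fun n y _ => (hasDerivAt_pow n y).const_mul _)
    (fun n y hy => by
      have : ‖y‖ < r := by simpa using hy
      rw [show p n * (n * y ^ (n - 1)) = (n * p n) * y ^ (n - 1) by ring, norm_mul, norm_pow]
      gcongr)
    (by simpa using lt_of_le_of_lt (norm_nonneg x) hr1)
    (hp.summable (by simp)) (by simpa using hr1)
  have hs2 : Summable fun n : ℕ => p n * (n * x ^ (n - 1)) := by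
    apply Summable.of_norm_bounded hs
    intro n
    rw [show p n * (n * x ^ (n - 1)) = (n * p n) * x ^ (n - 1) by ring, norm_mul, norm_pow]
    gcongr
  have e : S (dd p) x = ∑' n : ℕ, p n * (n * x ^ (n - 1)) := by
    rw [hs2.tsum_eq_zero_add]
    unfold S
    simp only [dd, CharP.cast_eq_zero, zero_mul, mul_zero, zero_add]
    congr 1; ext n; push_cast; ring
  rw [e]
  exact key

lemma S_congr {p q : ℕ → ℂ} (h : ∀ n, p n = q n) (x : ℂ) : S p x = S q x := by
  rw [funext h]

/-! ### asymptotics -/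

lemma poch_asymp (z : ℂ) :
    Tendsto (fun n : ℕ => poch z n * (n : ℂ) ^ (1 - z) / (n ! : ℂ)) atTop (𝓝 (Gamma z)⁻¹) := by
  by_cases hz : ∃ m : ℕ, z = -m
  · have hG : Gamma z = 0 := (Complex.Gamma_eq_zero_iff z).2 hz
    obtain ⟨m, hm⟩ := hz
    rw [hG, inv_zero]
    apply tendsto_const_nhds.congr'
    filter_upwards [eventually_gt_atTop m] with n hn
    have : poch z n = 0 := by
      rw [poch_eq_prod]
      exact Finset.prod_eq_zero (i := m) (by simpa using hn) (by simp [hm])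
    simp [this]
  · push Not at hz
    have hG : Gamma z ≠ 0 := Complex.Gamma_ne_zero hz
    have hk : ∀ k : ℕ, z + k ≠ 0 := fun k h => hz k (eq_neg_of_add_eq_zero_left h)
    have h1 := (Complex.GammaSeq_tendsto_Gamma z).inv₀ hG
    have h2 : Tendsto (fun n : ℕ => (z + n) / (n : ℂ)) atTop (𝓝 1) := by
      have : Tendsto (fun n : ℕ => z / (n : ℂ) + 1) atTop (𝓝 (0 + 1)) :=
        (tendsto_const_div_atTop_nhds_zero_nat z).add tendsto_const_nhds
      rw [zero_add] at this
      refine this.congr' ?_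
      filter_upwards [eventually_gt_atTop 0] with n hn
      have : (n : ℂ) ≠ 0 := by exact_mod_cast hn.ne'
      field_simp
    have h3 := h1.div h2 one_ne_zero
    rw [div_one] at h3
    refine h3.congr' ?_
    filter_upwards [eventually_gt_atTop 0] with n hn
    have hn' : (n : ℂ) ≠ 0 := by exact_mod_cast hn.ne'
    have e : (n : ℂ) ^ (1 - z) = n / (n : ℂ) ^ z := by
      rw [Complex.cpow_sub _ _ hn', Complex.cpow_one]
    have hne : (n : ℂ) ^ z ≠ 0 := by simp [Complex.cpow_eq_zero_iff, hn']
    have hf : (n ! : ℂ) ≠ 0 := by exact_mod_cast n.factorial_ne_zero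
    simp only [Pi.div_apply, Complex.GammaSeq, ← poch_eq_prod, poch_succ, e]
    have := hk n
    have := poch_ne_zero hk n
    field_simp

lemma coef_asymp {a b c : ℂ} (hc : ∀ k : ℕ, c + k ≠ 0) :
    Tendsto (fun n : ℕ => coef a b c n * (n : ℂ) ^ (c - a - b + 1)) atTop
      (𝓝 (Gamma c / (Gamma a * Gamma b))) := by
  have hG : Gamma c ≠ 0 := Complex.Gamma_ne_zero fun m h => hc m (by simp [h])
  have h := ((poch_asymp a).mul (poch_asymp b)).div (poch_asymp c) (inv_ne_zero hG)
  have e : (Gamma a)⁻¹ * (Gamma b)⁻¹ / (Gamma c)⁻¹ = Gamma c / (Gamma a * Gamma b) := by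
    rw [div_inv_eq_mul, div_eq_mul_inv, mul_inv]; ring
  rw [e] at h
  refine h.congr' ?_
  filter_upwards [eventually_gt_atTop 0] with n hn
  have hn' : (n : ℂ) ≠ 0 := by exact_mod_cast hn.ne'
  have hf : (n ! : ℂ) ≠ 0 := by exact_mod_cast n.factorial_ne_zero
  have hne : (n : ℂ) ^ (1 - c) ≠ 0 := by simp [Complex.cpow_eq_zero_iff, hn']
  have e : (n : ℂ) ^ (c - a - b + 1) = (n : ℂ) ^ (1 - a) * (n : ℂ) ^ (1 - b) / (n : ℂ) ^ (1 - c) := by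
    rw [← Complex.cpow_add _ _ hn', ← Complex.cpow_sub _ _ hn']
    congr 1; ring
  simp only [Pi.div_apply, coef, e]
  have := poch_ne_zero hc n
  field_simp

/-- norm bound for the coefficients -/
lemma coef_bound {a b c : ℂ} (hc : ∀ k : ℕ, c + k ≠ 0) :
    ∃ C : ℝ, 0 ≤ C ∧ ∀ n : ℕ, 0 < n → ‖coef a b c n‖ ≤ C * (n : ℝ) ^ (-(c - a - b).re - 1) := by
  obtain ⟨C, hC⟩ := (coef_asymp (a := a) (b := b) hc).norm.bddAbove_range
  have hC0 : 0 ≤ C := (norm_nonneg _).trans (hC ⟨0, rfl⟩)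
  refine ⟨C, hC0, fun n hn => ?_⟩
  have h := hC ⟨n, rfl⟩
  have hn' : (0 : ℝ) < n := by exact_mod_cast hn
  simp only [norm_mul, Complex.norm_natCast_cpow_of_pos hn] at h
  have hp : 0 < (n : ℝ) ^ (c - a - b + 1).re := Real.rpow_pos_of_pos hn' _
  rw [← le_div_iff₀ hp] at h
  refine h.trans (le_of_eq ?_)
  rw [div_eq_mul_inv, ← Real.rpow_neg hn'.le]
  congr 2
  simp; ring

lemma coef_good {a b c : ℂ} (hc : ∀ k : ℕ, c + k ≠ 0) : Good (coef a b c) := by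
  obtain ⟨C, hC, h⟩ := coef_bound (a := a) (b := b) hc
  obtain ⟨k, hk⟩ := exists_nat_ge (-(c - a - b).re - 1)
  refine ⟨C + ‖coef a b c 0‖, k, fun n => ?_⟩
  rcases Nat.eq_zero_or_pos n with rfl | hn
  · simp [hC]
  · have h1 : (1 : ℝ) ≤ n := by exact_mod_cast hn
    refine (h n hn).trans ?_
    have : (n : ℝ) ^ (-(c - a - b).re - 1) ≤ ((n : ℝ) + 1) ^ k := by
      calc (n : ℝ) ^ (-(c - a - b).re - 1) ≤ (n : ℝ) ^ (k : ℝ) :=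
            Real.rpow_le_rpow_of_exponent_le h1 hk
        _ = (n : ℝ) ^ k := Real.rpow_natCast _ _
        _ ≤ _ := by gcongr; linarith
    gcongr
    linarith [norm_nonneg (coef a b c 0)]

lemma coef_summable {a b c : ℂ} (hc : ∀ k : ℕ, c + k ≠ 0) (hs : 0 < (c - a - b).re) :
    Summable fun n => ‖coef a b c n‖ := by
  obtain ⟨C, hC, h⟩ := coef_bound (a := a) (b := b) hc
  rw [← summable_nat_add_iff 1]
  have h2 : Summable fun n : ℕ => (n : ℝ) ^ (-(c - a - b).re - 1) :=
    Real.summable_nat_rpow.2 (by linarith)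
  exact Summable.of_nonneg_of_le (fun n => norm_nonneg _) (fun n => h (n + 1) n.succ_pos)
    (((summable_nat_add_iff 1).2 h2).mul_left C)

/-! ### coefficient identities -/

lemma coef_zero (a b c : ℂ) : coef a b c 0 = 1 := by simp [coef, poch_zero]

lemma coef_succ {a b c : ℂ} (hc : ∀ k : ℕ, c + k ≠ 0) (n : ℕ) :
    ((n : ℂ) + 1) * (c + n) * coef a b c (n + 1) = (a + n) * (b + n) * coef a b c n := by
  have h1 := poch_ne_zero hc n
  have h2 := hc n
  have hf : (n ! : ℂ) ≠ 0 := by exact_mod_cast n.factorial_ne_zero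
  have hn : ((n : ℂ) + 1) ≠ 0 := by exact_mod_cast n.succ_ne_zero
  simp only [coef, poch_succ, Nat.factorial_succ]
  push_cast
  field_simp

lemma coef_ode {a b c : ℂ} (hc : ∀ k : ℕ, c + k ≠ 0) {x : ℂ} (hx : ‖x‖ < 1) :
    x * (1 - x) * S (dd (dd (coef a b c))) x + (c - (a + b + 1) * x) * S (dd (coef a b c)) x
      - a * b * S (coef a b c) x = 0 := by
  set p := coef a b c with hp
  have g : Good p := coef_good hc
  have key : S (fun n => (shift (dd (dd p)) n + (-1) * shift (shift (dd (dd p))) n)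
      + ((c * dd p n + (-(a + b + 1)) * shift (dd p) n) + (-(a * b)) * p n)) x = 0 := by
    have : ∀ n, (shift (dd (dd p)) n + (-1) * shift (shift (dd (dd p))) n)
      + ((c * dd p n + (-(a + b + 1)) * shift (dd p) n) + (-(a * b)) * p n) = 0 := by
      intro n
      have h := coef_succ (a := a) (b := b) hc n
      rw [← hp] at h
      rcases n with _ | _ | n
      · simp [shift, dd] at h ⊢
        linear_combination h
      · simp [shift, dd] at h ⊢
        linear_combination h
      · simp [shift, dd] at h ⊢
        linear_combination h
    rw [S_congr this]
    simp [S]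
  rw [S_add (g.dd.dd.shift.add (g.dd.dd.shift.shift.cmul _))
    (((g.dd.cmul _).add (g.dd.shift.cmul _)).add (g.cmul _)) hx,
    S_add g.dd.dd.shift (g.dd.dd.shift.shift.cmul _) hx,
    S_add ((g.dd.cmul _).add (g.dd.shift.cmul _)) (g.cmul _) hx,
    S_add (g.dd.cmul _) (g.dd.shift.cmul _) hx,
    S_cmul, S_cmul, S_cmul, S_cmul, S_shift g.dd.dd.shift hx, S_shift g.dd.dd hx,
    S_shift g.dd hx] at key
  linear_combination key

/-- raising `c` operator at 0 -/
lemma coef_shiftF {a b c : ℂ} (hc : ∀ k : ℕ, c + k ≠ 0) {x : ℂ} (hx : ‖x‖ < 1) :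
    x * S (dd (coef a b (c + 1))) x + c * S (coef a b (c + 1)) x = c * S (coef a b c) x := by
  have hc' : ∀ k : ℕ, c + 1 + k ≠ 0 := fun k => by
    have := hc (k + 1); push_cast at this; rwa [add_assoc, add_comm (1 : ℂ)]
  have g : Good (coef a b (c + 1)) := coef_good hc'
  rw [← S_shift g.dd hx, ← S_cmul, ← S_cmul, ← S_add g.dd.shift (g.cmul _) hx]
  apply S_congr
  intro n
  have h0 : shift (dd (coef a b (c + 1))) n = n * coef a b (c + 1) n := by
    cases n <;> simp [shift, dd]
  rw [h0]
  have h1 := poch_ne_zero hc n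
  have h2 := poch_ne_zero hc' n
  have hf : (n ! : ℂ) ≠ 0 := by exact_mod_cast n.factorial_ne_zero
  have h3 : poch c n * (c + n) = c * poch (c + 1) n := by
    rw [← poch_succ, poch_succ_left]
  simp only [coef]
  field_simp
  linear_combination poch a n * poch b n * h3

/-- the operator on the first solution at 1; here `e = a + b - c`. -/
lemma coef_shift1 {a b e : ℂ} (hc : ∀ k : ℕ, e + k ≠ 0) {t : ℂ} (hx : ‖t‖ < 1) :
    -(1 - t) * S (dd (coef a b e)) t + (a + b - e) * S (coef a b e) t
      = -((b - e) * (a - e) / e) * S (coef a b (e + 1)) t := by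
  have hc' : ∀ k : ℕ, e + 1 + k ≠ 0 := fun k => by
    have := hc (k + 1); push_cast at this; rwa [add_assoc, add_comm (1 : ℂ)]
  have g : Good (coef a b e) := coef_good hc
  have key : S (fun n => ((-1) * dd (coef a b e) n + shift (dd (coef a b e)) n)
      + (a + b - e) * coef a b e n) t
      = S (fun n => -((b - e) * (a - e) / e) * coef a b (e + 1) n) t := by
    apply S_congr
    intro n
    have h0 : shift (dd (coef a b e)) n = n * coef a b e n := by
      cases n <;> simp [shift, dd]
    have h := coef_succ (a := a) (b := b) hc n
    have h1 := poch_ne_zero hc n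
    have h2 := poch_ne_zero hc' n
    have hf : (n ! : ℂ) ≠ 0 := by exact_mod_cast n.factorial_ne_zero
    have he : e ≠ 0 := by simpa using hc 0
    have hen := hc n
    have h3 : poch e n * (e + n) = e * poch (e + 1) n := by
      rw [← poch_succ, poch_succ_left]
    have h4 : coef a b (e + 1) n = e * coef a b e n / (e + n) := by
      simp only [coef]
      field_simp
      linear_combination poch a n * poch b n * h3
    have h5 : dd (coef a b e) n = (a + n) * (b + n) * coef a b e n / (e + n) := by
      simp only [dd]
      field_simp
      linear_combination h
    rw [h0, h4, h5]
    field_simp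
    ring
  rw [S_add ((g.dd.cmul _).add g.dd.shift) (g.cmul _) hx, S_add (g.dd.cmul _) g.dd.shift hx,
    S_cmul, S_cmul, S_cmul, S_shift g.dd hx] at key
  linear_combination key

/-- the operator on the second solution at 1 (without power factor); here `f = c-a`, `g = c-b`,
`e = c-a-b+1`. -/
lemma coef_shift2 {f g e : ℂ} (hc : ∀ k : ℕ, e + k ≠ 0) {t : ℂ} (hx : ‖t‖ < 1) :
    -(1 - t) * (e * S (coef (f + 1) (g + 1) (e + 1)) t
        + t * S (dd (coef (f + 1) (g + 1) (e + 1))) t)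
      + (f + g - e + 1) * t * S (coef (f + 1) (g + 1) (e + 1)) t
      = - e * S (coef f g e) t := by
  have hc' : ∀ k : ℕ, e + 1 + k ≠ 0 := fun k => by
    have := hc (k + 1); push_cast at this; rwa [add_assoc, add_comm (1 : ℂ)]
  set p := coef (f + 1) (g + 1) (e + 1) with hp
  have gd : Good p := coef_good hc'
  have key : S (fun n => ((-e) * p n + (-1) * shift (dd p) n) +
      (shift (shift (dd p)) n + (f + g + 1) * shift p n)) t
      = S (fun n => (-e) * coef f g e n) t := by
    apply S_congr
    intro n
    have he : e ≠ 0 := by simpa using hc 0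
    rcases n with _ | n
    · simp [shift, hp, coef_zero]
    · have h0 : shift (dd p) n = n * p n := by
        cases n <;> simp [shift, dd]
      have h := coef_succ (a := f + 1) (b := g + 1) hc' n
      rw [← hp] at h
      have hf : (n ! : ℂ) ≠ 0 := by exact_mod_cast n.factorial_ne_zero
      have hn : ((n : ℂ) + 1) ≠ 0 := by exact_mod_cast n.succ_ne_zero
      have hen := hc' n
      have h2 := poch_ne_zero hc' n
      have h4 : coef f g e (n + 1) = f * g / (e * (n + 1)) * p n := by
        simp only [hp, coef, poch_succ_left, Nat.factorial_succ]
        push_cast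
        field_simp
      have h5 : p (n + 1) = (f + 1 + n) * (g + 1 + n) * p n / ((n + 1) * (e + 1 + n)) := by
        field_simp
        linear_combination h
      simp only [shift_succ, h0]
      simp only [dd]
      rw [h4, h5]
      field_simp
      ring
  rw [S_add ((gd.cmul _).add (gd.dd.shift.cmul _)) (gd.dd.shift.shift.add (gd.shift.cmul _)) hx,
    S_add (gd.cmul _) (gd.dd.shift.cmul _) hx, S_add gd.dd.shift.shift (gd.shift.cmul _) hx,
    S_cmul, S_cmul, S_cmul, S_cmul, S_shift gd.dd.shift hx, S_shift gd.dd hx,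
    S_shift gd hx] at key
  linear_combination key

/-- binomial series -/
lemma binom (r : ℂ) {x : ℂ} (hx : ‖x‖ < 1) : S (coef r 1 1) x = (1 - x) ^ (-r) := by
  have h1 : ∀ k : ℕ, (1 : ℂ) + k ≠ 0 := fun k => by
    rw [add_comm]; exact_mod_cast k.succ_ne_zero
  have g : Good (coef r 1 1) := coef_good h1
  have ode : ∀ x : ℂ, ‖x‖ < 1 → (1 - x) * S (dd (coef r 1 1)) x = r * S (coef r 1 1) x := by
    intro x hx
    have key : S (fun n => dd (coef r 1 1) n + (-1) * shift (dd (coef r 1 1)) n) x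
        = S (fun n => r * coef r 1 1 n) x := by
      apply S_congr
      intro n
      have h0 : shift (dd (coef r 1 1)) n = n * coef r 1 1 n := by
        cases n <;> simp [shift, dd]
      have h := coef_succ (a := r) (b := 1) h1 n
      rw [h0]
      simp only [dd]
      have := h1 n
      apply mul_left_cancel₀ this
      linear_combination h
    rw [S_add g.dd (g.dd.shift.cmul _) hx, S_cmul, S_cmul, S_shift g.dd hx] at key
    linear_combination key
  have slit : ∀ x : ℂ, ‖x‖ < 1 → 1 - x ∈ slitPlane := by
    intro x hx
    rw [sub_eq_add_neg]
    exact Complex.mem_slitPlane_of_norm_lt_one (by simpa using hx)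
  have hd : ∀ x ∈ Metric.ball (0 : ℂ) 1,
      HasDerivAt (fun x => (1 - x) ^ r * S (coef r 1 1) x) 0 x := by
    intro x hx
    have hx : ‖x‖ < 1 := by simpa using hx
    have d1 := (((hasDerivAt_id x).const_sub 1).cpow_const (c := r) (slit x hx)).mul
      (hasDerivAt_S g hx)
    refine HasDerivAt.congr_deriv d1 ?_
    simp only [id_eq]
    have hne : 1 - x ≠ 0 := slitPlane_ne_zero (slit x hx)
    have := ode x hx
    rw [Complex.cpow_sub _ _ hne, Complex.cpow_one]
    field_simp
    linear_combination (1 - x) ^ r * this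
  have hconst := Metric.isOpen_ball.is_const_of_deriv_eq_zero
    (convex_ball (0 : ℂ) 1).isPreconnected
    (fun x hx => (hd x hx).differentiableAt.differentiableWithinAt)
    (fun x hx => (hd x hx).deriv) (x := x) (y := 0) (by simpa using hx) (by simp)
  simp only [S_zero, coef_zero, sub_zero, one_cpow, mul_one] at hconst
  have hne : 1 - x ≠ 0 := slitPlane_ne_zero (slit x hx)
  rw [Complex.cpow_neg]
  exact eq_inv_of_mul_eq_one_right hconst

/-! ### solutions of the differential equation -/

/-- the lens -/
def U : Set ℂ := Metric.ball 0 1 ∩ Metric.ball 1 1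

lemma mem_U {x : ℂ} : x ∈ U ↔ ‖x‖ < 1 ∧ ‖1 - x‖ < 1 := by
  simp [U, dist_eq_norm, norm_sub_rev]

lemma isOpen_U : IsOpen U := Metric.isOpen_ball.inter Metric.isOpen_ball

lemma preconn_U : IsPreconnected U :=
  ((convex_ball _ _).inter (convex_ball _ _)).isPreconnected

lemma slit0 {x : ℂ} (hx : x ∈ U) : x ∈ slitPlane := by
  have := Complex.mem_slitPlane_of_norm_lt_one (z := -(1 - x)) (by rw [norm_neg]; exact (mem_U.1 hx).2)
  simpa using this

lemma slit1 {x : ℂ} (hx : x ∈ U) : 1 - x ∈ slitPlane := by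
  rw [sub_eq_add_neg]
  exact Complex.mem_slitPlane_of_norm_lt_one (by simpa using (mem_U.1 hx).1)

lemma ofReal_mem_U {ξ : ℝ} (h : ξ ∈ Set.Ioo (0 : ℝ) 1) : (ξ : ℂ) ∈ U := by
  rw [mem_U]
  have : (1 : ℂ) - ξ = ((1 - ξ : ℝ) : ℂ) := by push_cast; ring
  rw [this, Complex.norm_real, Complex.norm_real, Real.norm_eq_abs, Real.norm_eq_abs, abs_lt, abs_lt]
  constructor <;> constructor <;> linarith [h.1, h.2]

/-- solution of the hypergeometric ODE on `U` -/
def IsSol (a b c : ℂ) (y y1 : ℂ → ℂ) : Prop := ∀ x ∈ U, HasDerivAt y (y1 x) x ∧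
  ∃ y2, HasDerivAt y1 y2 x ∧
    x * (1 - x) * y2 + (c - (a + b + 1) * x) * y1 x - a * b * y x = 0

/-- weighted Wronskian -/
noncomputable def W (a b c : ℂ) (y y1 z z1 : ℂ → ℂ) (x : ℂ) : ℂ :=
  x ^ c * (1 - x) ^ (1 - (c - a - b)) * (y x * z1 x - y1 x * z x)

lemma W_const {a b c : ℂ} {y y1 z z1 : ℂ → ℂ} (hy : IsSol a b c y y1) (hz : IsSol a b c z z1)
    {p q : ℂ} (hp : p ∈ U) (hq : q ∈ U) : W a b c y y1 z z1 p = W a b c y y1 z z1 q := by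
  have hd : ∀ x ∈ U, HasDerivAt (W a b c y y1 z z1) 0 x := by
    intro x hx
    obtain ⟨dy, y2, dy1, oy⟩ := hy x hx
    obtain ⟨dz, z2, dz1, oz⟩ := hz x hx
    have d := ((((hasDerivAt_id x).cpow_const (c := c) (slit0 hx))).mul
      (((hasDerivAt_id x).const_sub 1).cpow_const (c := 1 - (c - a - b)) (slit1 hx))).mul
      ((dy.mul dz1).sub (dy1.mul dz))
    have h0 : x ≠ 0 := slitPlane_ne_zero (slit0 hx)
    have h1 : 1 - x ≠ 0 := slitPlane_ne_zero (slit1 hx)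
    refine HasDerivAt.congr_deriv d ?_
    simp only [id_eq, Pi.mul_apply, Pi.sub_apply]
    rw [Complex.cpow_sub _ _ h0, Complex.cpow_sub _ 1 h1, Complex.cpow_one, Complex.cpow_one]
    field_simp
    linear_combination x ^ c * (1 - x) ^ (1 - (c - a - b)) * y x * oz
      - x ^ c * (1 - x) ^ (1 - (c - a - b)) * z x * oy
  exact isOpen_U.is_const_of_deriv_eq_zero preconn_U
    (fun x hx => (hd x hx).differentiableAt.differentiableWithinAt)
    (fun x hx => (hd x hx).deriv) hp hq

/-- solution at zero -/
lemma isSol_F {a b c : ℂ} (hc : ∀ k : ℕ, c + k ≠ 0) :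
    IsSol a b c (S (coef a b c)) (S (dd (coef a b c))) := fun x hx =>
  ⟨hasDerivAt_S (coef_good hc) (mem_U.1 hx).1, _,
    hasDerivAt_S (coef_good hc).dd (mem_U.1 hx).1, coef_ode hc (mem_U.1 hx).1⟩

/-- first solution at one -/
noncomputable def u1 (a b c x : ℂ) : ℂ := S (coef a b (a + b - c + 1)) (1 - x)
/-- its derivative -/
noncomputable def u1' (a b c x : ℂ) : ℂ := -S (dd (coef a b (a + b - c + 1))) (1 - x)
/-- second solution at one -/
noncomputable def u2 (a b c x : ℂ) : ℂ :=
  (1 - x) ^ (c - a - b) * S (coef (c - a) (c - b) (c - a - b + 1)) (1 - x)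
/-- its derivative -/
noncomputable def u2' (a b c x : ℂ) : ℂ :=
  -((c - a - b) * (1 - x) ^ (c - a - b - 1) * S (coef (c - a) (c - b) (c - a - b + 1)) (1 - x)
    + (1 - x) ^ (c - a - b) * S (dd (coef (c - a) (c - b) (c - a - b + 1))) (1 - x))

lemma hasDerivAt_S1 {p : ℕ → ℂ} (hp : Good p) {x : ℂ} (h1 : ‖1 - x‖ < 1) :
    HasDerivAt (fun x => S p (1 - x)) (-S (dd p) (1 - x)) x := by
  have := (hasDerivAt_S hp h1).comp x ((hasDerivAt_id x).const_sub 1)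
  simpa using! this

lemma hasDerivAt_pow1 (s : ℂ) {x : ℂ} (hx : x ∈ U) :
    HasDerivAt (fun x : ℂ => (1 - x) ^ s) (-(s * (1 - x) ^ (s - 1))) x := by
  have := ((hasDerivAt_id x).const_sub 1).cpow_const (c := s) (slit1 hx)
  simpa using! this

/-- not an integer -/
def NI (z : ℂ) : Prop := ∀ k : ℤ, z ≠ k

lemma NI.add_int {z : ℂ} (h : NI z) (m : ℤ) : NI (z + m) := fun k hk =>
  h (k - m) (by push_cast; rw [← hk]; ring)

lemma NI.neg {z : ℂ} (h : NI z) : NI (-z) := fun k hk =>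
  h (-k) (by push_cast; rw [← hk]; ring)

lemma NI.nat {z : ℂ} (h : NI z) (k : ℕ) : z + k ≠ 0 := fun hk =>
  h (-k) (by push_cast; linear_combination hk)

lemma NI.ne {z : ℂ} (h : NI z) : z ≠ 0 := by simpa using h.nat 0

lemma NI.one {z : ℂ} (h : NI z) : NI (z + 1) := by simpa using h.add_int 1

lemma NI.e1 {a b c : ℂ} (h : NI (c - a - b)) : NI (a + b - c) := by
  convert h.neg using 1; ring

lemma isSol_u1 {a b c : ℂ} (hs : NI (c - a - b)) : IsSol a b c (u1 a b c) (u1' a b c) := by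
  intro x hx
  have hx1 := (mem_U.1 hx).2
  have g : Good (coef a b (a + b - c + 1)) := coef_good hs.e1.one.nat
  refine ⟨hasDerivAt_S1 g hx1, _, (hasDerivAt_S1 g.dd hx1).neg, ?_⟩
  have := coef_ode (a := a) (b := b) hs.e1.one.nat hx1
  simp only [u1, u1']
  linear_combination this

lemma isSol_u2 {a b c : ℂ} (hs : NI (c - a - b)) : IsSol a b c (u2 a b c) (u2' a b c) := by
  intro x hx
  have hx1 := (mem_U.1 hx).2
  have g : Good (coef (c - a) (c - b) (c - a - b + 1)) := coef_good hs.one.nat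
  have h1 : 1 - x ≠ 0 := slitPlane_ne_zero (slit1 hx)
  refine ⟨?_, _, ((((hasDerivAt_pow1 (c - a - b - 1) hx).const_mul (c - a - b)).mul
    (hasDerivAt_S1 g hx1)).add ((hasDerivAt_pow1 (c - a - b) hx).mul (hasDerivAt_S1 g.dd hx1))).neg, ?_⟩
  · refine HasDerivAt.congr_deriv ((hasDerivAt_pow1 (c - a - b) hx).mul (hasDerivAt_S1 g hx1)) ?_
    simp only [u2']
    ring
  · have := coef_ode (a := c - a) (b := c - b) hs.one.nat hx1
    simp only [u2, u2']
    rw [Complex.cpow_sub _ 1 h1, Complex.cpow_sub _ 1 h1, Complex.cpow_one]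
    field_simp
    linear_combination (1 - x) ^ (c - a - b) * (1 - x) * this

/-- approach to one -/
lemma tendsto_one_sub : Tendsto (fun ξ : ℝ => (1 : ℂ) - ξ) (𝓝[<] 1) (𝓝 0) := by
  have : ContinuousAt (fun ξ : ℝ => (1 : ℂ) - ξ) 1 := by fun_prop
  have := this.tendsto.mono_left (nhdsWithin_le_nhds (s := Set.Iio 1))
  simpa using this

lemma ev_Ioo : ∀ᶠ ξ : ℝ in 𝓝[<] 1, ξ ∈ Set.Ioo (0 : ℝ) 1 :=
  Ioo_mem_nhdsLT one_pos

lemma tendsto_S1 {p : ℕ → ℂ} (hp : Good p) :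
    Tendsto (fun ξ : ℝ => S p (1 - ξ)) (𝓝[<] 1) (𝓝 (p 0)) := by
  have := (hasDerivAt_S hp (x := 0) (by simp)).continuousAt.tendsto.comp tendsto_one_sub
  simpa [S_zero, Function.comp_def] using! this

lemma W_u1u2 {a b c : ℂ} (hs : NI (c - a - b)) {p : ℂ} (hp : p ∈ U) :
    W a b c (u1 a b c) (u1' a b c) (u2 a b c) (u2' a b c) p = -(c - a - b) := by
  have g1 : Good (coef a b (a + b - c + 1)) := coef_good hs.e1.one.nat
  have g2 : Good (coef (c - a) (c - b) (c - a - b + 1)) := coef_good hs.one.nat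
  have t0 : Tendsto (fun ξ : ℝ => (ξ : ℂ) ^ c) (𝓝[<] 1) (𝓝 1) := by
    have : ContinuousAt (fun z : ℂ => z ^ c) ((1 : ℝ) : ℂ) :=
      continuousAt_cpow_const (by simp)
    have := (this.comp (Complex.continuous_ofReal.continuousAt)).tendsto.mono_left
      (nhdsWithin_le_nhds (s := Set.Iio 1))
    simpa [Function.comp_def] using! this
  have T := t0.mul (((((tendsto_S1 g1).mul (tendsto_S1 g2)).const_mul (-(c - a - b))).sub
    ((tendsto_one_sub.mul (tendsto_S1 g1)).mul (tendsto_S1 g2.dd))).add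
    ((tendsto_one_sub.mul (tendsto_S1 g1.dd)).mul (tendsto_S1 g2)))
  have T2 : Tendsto (fun ξ : ℝ => W a b c (u1 a b c) (u1' a b c) (u2 a b c) (u2' a b c) ξ)
      (𝓝[<] 1) (𝓝 (-(c - a - b))) := by
    simp only [coef_zero] at T
    have e : (1 : ℂ) * (-(c - a - b) * (1 * 1) -
        0 * 1 * dd (coef (c - a) (c - b) (c - a - b + 1)) 0 +
        0 * dd (coef a b (a + b - c + 1)) 0 * 1) = -(c - a - b) := by ring
    rw [e] at T
    refine T.congr' ?_
    filter_upwards [ev_Ioo] with ξ hξ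
    have h1 : (1 : ℂ) - ξ ≠ 0 := slitPlane_ne_zero (slit1 (ofReal_mem_U hξ))
    have hne : ((1 : ℂ) - ξ) ^ (c - a - b) ≠ 0 := by simp [Complex.cpow_eq_zero_iff, h1]
    simp only [W, u1, u1', u2, u2']
    rw [Complex.cpow_sub _ 1 h1, Complex.cpow_sub 1 _ h1, Complex.cpow_one]
    field_simp
    ring
  refine tendsto_nhds_unique (tendsto_const_nhds.congr' ?_) T2
  filter_upwards [ev_Ioo] with ξ hξ
  exact W_const (isSol_u1 hs) (isSol_u2 hs) hp (ofReal_mem_U hξ)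

/-- connection relation with constants A, B -/
def Conn (a b c A B : ℂ) : Prop :=
  ∀ x ∈ U, S (coef a b c) x = A * u1 a b c x + B * u2 a b c x

lemma exists_conn {a b c : ℂ} (hc : NI c) (hs : NI (c - a - b)) : ∃ A B, Conn a b c A B := by
  have hF := isSol_F (a := a) (b := b) hc.nat
  have h0 : (2⁻¹ : ℂ) ∈ U := by rw [mem_U]; norm_num
  refine ⟨W a b c (S (coef a b c)) (S (dd (coef a b c))) (u2 a b c) (u2' a b c) 2⁻¹ / (-(c - a - b)),
    W a b c (u1 a b c) (u1' a b c) (S (coef a b c)) (S (dd (coef a b c))) 2⁻¹ / (-(c - a - b)),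
    fun x hx => ?_⟩
  rw [W_const hF (isSol_u2 hs) h0 hx, W_const (isSol_u1 hs) hF h0 hx]
  have hw := W_u1u2 hs hx
  have hne : -(c - a - b) ≠ 0 := hs.neg.ne
  rw [div_mul_eq_mul_div, div_mul_eq_mul_div, ← add_div, eq_div_iff hne, ← hw]
  simp only [W]
  ring

lemma conn_unique {a b c A B A' B' : ℂ} (hs : NI (c - a - b))
    (h : Conn a b c A B) (h' : Conn a b c A' B') : A = A' ∧ B = B' := by
  have h0 : (2⁻¹ : ℂ) ∈ U := by rw [mem_U]; norm_num
  have hz : ∀ x ∈ U, (A - A') * u1 a b c x + (B - B') * u2 a b c x = 0 := by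
    intro x hx
    linear_combination h' x hx - h x hx
  have hd : (A - A') * u1' a b c 2⁻¹ + (B - B') * u2' a b c 2⁻¹ = 0 := by
    have d := ((isSol_u1 hs _ h0).1.const_mul (A - A')).add
      ((isSol_u2 hs _ h0).1.const_mul (B - B'))
    have d2 : HasDerivAt (fun _ : ℂ => (0 : ℂ)) 0 2⁻¹ := hasDerivAt_const _ _
    refine d.unique (d2.congr_of_eventuallyEq ?_)
    filter_upwards [isOpen_U.mem_nhds h0] with x hx
    exact hz x hx
  have hw := W_u1u2 hs h0
  have hv := hz _ h0
  have hne : -(c - a - b) ≠ 0 := hs.neg.ne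
  rw [W] at hw
  constructor
  · apply sub_eq_zero.1
    apply (mul_eq_zero.1 _).resolve_right hne
    rw [← hw]
    linear_combination ((2⁻¹ : ℂ) ^ c * (1 - 2⁻¹) ^ (1 - (c - a - b))) *
      (u2' a b c 2⁻¹ * hv - u2 a b c 2⁻¹ * hd)
  · apply sub_eq_zero.1
    apply (mul_eq_zero.1 _).resolve_right hne
    rw [← hw]
    linear_combination ((2⁻¹ : ℂ) ^ c * (1 - 2⁻¹) ^ (1 - (c - a - b))) *
      (u1 a b c 2⁻¹ * hd - u1' a b c 2⁻¹ * hv)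

lemma conn_shift {a b c A B : ℂ} (hc : NI c) (hs : NI (c - a - b)) (h : Conn a b (c + 1) A B) :
    Conn a b c ((c - a) * (c - b) / (c * (c - a - b)) * A) (-(c - a - b + 1) / c * B) := by
  intro x hx
  have hs' : NI (c + 1 - a - b) := by
    convert hs.one using 1; ring
  have hx0 := (mem_U.1 hx).1
  have hx1 := (mem_U.1 hx).2
  have d := ((isSol_u1 hs' _ hx).1.const_mul A).add ((isSol_u2 hs' _ hx).1.const_mul B)
  have d0 := (isSol_F (a := a) (b := b) hc.one.nat _ hx).1
  have hd : S (dd (coef a b (c + 1))) x = A * u1' a b (c + 1) x + B * u2' a b (c + 1) x := by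
    refine d0.unique (d.congr_of_eventuallyEq ?_)
    filter_upwards [isOpen_U.mem_nhds hx] with x hx
    exact h x hx
  have hF := coef_shiftF (a := a) (b := b) hc.nat hx0
  rw [hd, h x hx] at hF
  have k1 := coef_shift1 (a := a) (b := b) hs.e1.nat hx1
  have k2 := coef_shift2 (f := c - a) (g := c - b) hs.one.nat hx1
  have h1 : 1 - x ≠ 0 := slitPlane_ne_zero (slit1 hx)
  have hcne := hc.ne
  have hsne := hs.ne
  simp only [u1, u1', u2, u2'] at hF ⊢
  rw [show a + b - (c + 1) + 1 = a + b - c by ring, show c + 1 - a = c - a + 1 by ring,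
    show c + 1 - b = c - b + 1 by ring, show c - a + 1 - b = c - a - b + 1 by ring,
    show c - a - b + 1 - 1 = c - a - b by ring,
    Complex.cpow_add _ _ h1, Complex.cpow_one] at hF
  have e : (b - (a + b - c)) * (a - (a + b - c)) / (a + b - c)
      = - ((c - a) * (c - b) / (c - a - b)) := by
    rw [← neg_sub, show a + b - c = -(c - a - b) by ring, div_neg]
    ring
  rw [e] at k1
  apply mul_left_cancel₀ hcne
  rw [← hF]
  have e2 : c * ((c - a) * (c - b) / (c * (c - a - b)) * A *
      S (coef a b (a + b - c + 1)) (1 - x) +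
      -(c - a - b + 1) / c * B *
      ((1 - x) ^ (c - a - b) * S (coef (c - a) (c - b) (c - a - b + 1)) (1 - x)))
      = A * (((c - a) * (c - b) / (c - a - b)) * S (coef a b (a + b - c + 1)) (1 - x))
      + B * (1 - x) ^ (c - a - b) *
        (-(c - a - b + 1) * S (coef (c - a) (c - b) (c - a - b + 1)) (1 - x)) := by
    field_simp
  rw [e2]
  linear_combination A * k1 + B * (1 - x) ^ (c - a - b) * k2

/-! ### determination of the constants -/

lemma norm_pow1 (s : ℂ) {ξ : ℝ} (h : ξ ∈ Set.Ioo (0 : ℝ) 1) :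
    ‖((1 : ℂ) - ξ) ^ s‖ = (1 - ξ) ^ s.re := by
  have : (1 : ℂ) - ξ = ((1 - ξ : ℝ) : ℂ) := by push_cast; ring
  rw [this, Complex.norm_cpow_eq_rpow_re_of_pos (by linarith [h.2])]

lemma tendsto_rpow1 {r : ℝ} (hr : 0 < r) :
    Tendsto (fun ξ : ℝ => (1 - ξ) ^ r) (𝓝[<] 1) (𝓝 0) := by
  have : ContinuousAt (fun ξ : ℝ => (1 - ξ) ^ r) 1 :=
    (continuousAt_const.sub continuousAt_id).rpow_const (Or.inr hr.le)
  have := this.tendsto.mono_left (nhdsWithin_le_nhds (s := Set.Iio 1))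
  simpa [Real.zero_rpow hr.ne'] using this

lemma tendsto_pow1 {s : ℂ} (hs : 0 < s.re) :
    Tendsto (fun ξ : ℝ => ((1 : ℂ) - ξ) ^ s) (𝓝[<] 1) (𝓝 0) := by
  rw [tendsto_zero_iff_norm_tendsto_zero]
  refine (tendsto_rpow1 hs).congr' ?_
  filter_upwards [ev_Ioo] with ξ hξ
  rw [norm_pow1 s hξ]

lemma conn_A_of_pos {a b c A B : ℂ} (hc : NI c) (hs : NI (c - a - b)) (hre : 0 < (c - a - b).re)
    (h : Conn a b c A B) : A = ∑' n, coef a b c n := by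
  have g1 : Good (coef a b (a + b - c + 1)) := coef_good hs.e1.one.nat
  have g2 : Good (coef (c - a) (c - b) (c - a - b + 1)) := coef_good hs.one.nat
  have T1 : Tendsto (fun ξ : ℝ => S (coef a b c) ξ) (𝓝[<] 1) (𝓝 (∑' n, coef a b c n)) := by
    refine tendsto_tsum_of_dominated_convergence (coef_summable (a := a) (b := b) hc.nat hre) ?_ ?_
    · intro n
      have : ContinuousAt (fun ξ : ℝ => coef a b c n * (ξ : ℂ) ^ n) 1 := by fun_prop
      have := this.tendsto.mono_left (nhdsWithin_le_nhds (s := Set.Iio 1))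
      simpa using this
    · filter_upwards [ev_Ioo] with ξ hξ n
      rw [norm_mul, norm_pow, Complex.norm_real, Real.norm_of_nonneg hξ.1.le]
      exact mul_le_of_le_one_right (norm_nonneg _) (pow_le_one₀ hξ.1.le hξ.2.le)
  have T2 := ((tendsto_S1 g1).const_mul A).add
    (((tendsto_pow1 hre).mul (tendsto_S1 g2)).const_mul B)
  simp only [coef_zero, mul_one, mul_zero, add_zero] at T2
  refine tendsto_nhds_unique T2 (T1.congr' ?_)
  filter_upwards [ev_Ioo] with ξ hξ
  exact h _ (ofReal_mem_U hξ)

lemma tendsto_coef_sum (a b c : ℂ) :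
    Tendsto (fun N : ℕ => ∑' n, coef a b (c + N) n) atTop (𝓝 1) := by
  obtain ⟨R, hR⟩ := exists_nat_gt (max 0 (a.re + b.re))
  have hR0 : (0 : ℝ) < R := (le_max_left _ _).trans_lt hR
  have hR1 : a.re + b.re < R := (le_max_right _ _).trans_lt hR
  have hRk : ∀ k : ℕ, (R : ℂ) + k ≠ 0 := fun k => by
    have : R ≠ 0 := by rintro rfl; simp at hR0
    exact_mod_cast (by omega : R + k ≠ 0)
  obtain ⟨N0, hN0⟩ := exists_nat_gt (R - c.re)
  have hev : ∀ N : ℕ, N0 ≤ N → ∀ j : ℕ, ‖(R : ℂ) + j‖ ≤ ‖c + N + j‖ := by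
    intro N hN j
    have h1 : (N0 : ℝ) ≤ N := by exact_mod_cast hN
    calc ‖(R : ℂ) + j‖ = (R : ℝ) + j := by
          rw [← Nat.cast_add, Complex.norm_natCast]; push_cast; ring
      _ ≤ (c + N + j).re := by simp; linarith
      _ ≤ _ := Complex.re_le_norm _
  have hpoch : ∀ N : ℕ, N0 ≤ N → ∀ n : ℕ, ‖poch R n‖ ≤ ‖poch (c + N) n‖ := by
    intro N hN n
    rw [poch_eq_prod, poch_eq_prod, norm_prod, norm_prod]
    exact Finset.prod_le_prod (fun _ _ => norm_nonneg _) fun j _ => hev N hN j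
  have hsum := coef_summable (a := a) (b := b) (c := R) hRk (by simp; linarith)
  have key := tendsto_tsum_of_dominated_convergence (𝓕 := atTop)
    (f := fun (N : ℕ) (n : ℕ) => coef a b (c + N) n) (g := fun n => if n = 0 then (1 : ℂ) else 0)
    hsum ?_ ?_
  · simpa using key
  · intro n
    rcases n with _ | n
    · simp [coef_zero]
    · simp only [Nat.add_eq_zero_iff, one_ne_zero, and_false, if_false]
      have hinf : Tendsto (fun N : ℕ => ‖poch (c + N) (n + 1)‖) atTop atTop := by
        have h1 : Tendsto (fun N : ℕ => ((N : ℝ) + c.re) * ‖poch (R : ℂ) n‖) atTop atTop := by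
          apply Tendsto.atTop_mul_const (norm_pos_iff.2 (poch_ne_zero hRk n))
          exact tendsto_atTop_add_const_right _ _ tendsto_natCast_atTop_atTop
        refine tendsto_atTop_mono' _ ?_ h1
        filter_upwards [eventually_ge_atTop N0] with N hN
        rw [poch_succ, norm_mul, mul_comm]
        refine mul_le_mul (hpoch N hN n) ?_ ?_ (norm_nonneg _)
        · calc (N : ℝ) + c.re ≤ (c + N + n).re := by simp; linarith
            _ ≤ _ := Complex.re_le_norm _
        · have h1 : (N0 : ℝ) ≤ N := by exact_mod_cast hN
          linarith
      rw [tendsto_zero_iff_norm_tendsto_zero]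
      have := hinf.inv_tendsto_atTop.const_mul
        (‖poch a (n + 1) * poch b (n + 1)‖ / ‖((n + 1)! : ℂ)‖)
      rw [mul_zero] at this
      refine this.congr fun N => ?_
      simp only [coef, norm_div, norm_mul, Pi.inv_apply]
      rw [div_mul_eq_div_div_swap]; rfl
  · filter_upwards [eventually_ge_atTop N0] with N hN n
    simp only [coef, norm_div, norm_mul]
    have h0 : 0 < ‖poch (R : ℂ) n‖ := norm_pos_iff.2 (poch_ne_zero hRk n)
    have hf : 0 < ‖(n ! : ℂ)‖ := norm_pos_iff.2 (by exact_mod_cast n.factorial_ne_zero)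
    have := hpoch N hN n
    gcongr

lemma conn_A {a b c A B : ℂ} (hc : NI c) (hs : NI (c - a - b)) (h : Conn a b c A B) :
    A = Gamma c * Gamma (c - a - b) / (Gamma (c - a) * Gamma (c - b)) := by
  have hcN : ∀ N : ℕ, NI (c + N) := fun N => by simpa using hc.add_int N
  have hsN : ∀ N : ℕ, NI (c + N - a - b) := fun N => by
    have := hs.add_int N
    convert this using 1
    push_cast; ring
  choose A' B' h' using fun N : ℕ => exists_conn (a := a) (b := b) (hcN N) (hsN N)
  have hrec : ∀ N : ℕ, A' N = (c - a + N) * (c - b + N) / ((c + N) * (c - a - b + N)) * A' (N + 1) := by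
    intro N
    have h1 := h' (N + 1)
    rw [show c + ((N + 1 : ℕ) : ℂ) = c + N + 1 by push_cast; ring] at h1
    have := (conn_unique (hsN N) (h' N) (conn_shift (hcN N) (hsN N) h1)).1
    rw [this, show c + N - a = c - a + N by ring, show c + N - b = c - b + N by ring,
      show c - a + N - b = c - a - b + N by ring]
  have hA0 : A' 0 = A := by
    have h0 := h' 0
    rw [Nat.cast_zero, add_zero] at h0
    exact (conn_unique hs h0 h).1
  have hprod : ∀ N : ℕ, A = poch (c - a) N * poch (c - b) N / (poch c N * poch (c - a - b) N) * A' N := by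
    intro N
    induction N with
    | zero => simp [poch_zero, hA0]
    | succ N ih =>
      rw [ih, hrec N]
      simp only [poch_succ]
      rw [← mul_assoc, div_mul_div_comm]
      congr 2 <;> ring
  have hGc : Gamma c ≠ 0 := Complex.Gamma_ne_zero fun m h => hc.nat m (by simp [h])
  have hGs : Gamma (c - a - b) ≠ 0 := Complex.Gamma_ne_zero fun m h => hs.nat m (by simp [h])
  have TP := ((poch_asymp (c - a)).mul (poch_asymp (c - b))).div
    ((poch_asymp c).mul (poch_asymp (c - a - b))) (mul_ne_zero (inv_ne_zero hGc) (inv_ne_zero hGs))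
  have TA : Tendsto A' atTop (𝓝 1) := by
    refine (tendsto_coef_sum a b c).congr' ?_
    obtain ⟨N0, hN0⟩ := exists_nat_gt (-(c - a - b).re)
    filter_upwards [eventually_ge_atTop N0] with N hN
    have h1 : (N0 : ℝ) ≤ N := by exact_mod_cast hN
    refine (conn_A_of_pos (hcN N) (hsN N) ?_ (h' N)).symm
    simp at hN0 ⊢
    linarith
  have T := TP.mul TA
  have e : (Gamma (c - a))⁻¹ * (Gamma (c - b))⁻¹ / ((Gamma c)⁻¹ * (Gamma (c - a - b))⁻¹) * 1
      = Gamma c * Gamma (c - a - b) / (Gamma (c - a) * Gamma (c - b)) := by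
    rw [← mul_inv, ← mul_inv, div_inv_eq_mul, mul_one, div_eq_mul_inv, mul_comm]
  rw [e] at T
  refine tendsto_nhds_unique (tendsto_const_nhds.congr' ?_) T
  filter_upwards [eventually_gt_atTop 0] with N hN
  have hn' : (N : ℂ) ≠ 0 := by exact_mod_cast hN.ne'
  have hf : (N ! : ℂ) ≠ 0 := by exact_mod_cast N.factorial_ne_zero
  have hne : ∀ z : ℂ, (N : ℂ) ^ z ≠ 0 := fun z => by simp [Complex.cpow_eq_zero_iff, hn']
  have hpow : (N : ℂ) ^ (1 - (c - a)) * (N : ℂ) ^ (1 - (c - b))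
      = (N : ℂ) ^ (1 - c) * (N : ℂ) ^ (1 - (c - a - b)) := by
    rw [← Complex.cpow_add _ _ hn', ← Complex.cpow_add _ _ hn']
    congr 1; ring
  have h1 := poch_ne_zero hc.nat N
  have h2 := poch_ne_zero hs.nat N
  rw [hprod N]
  congr 1
  simp only [Pi.div_apply]
  have h3 := hne (1 - c)
  have h4 := hne (1 - (c - a - b))
  rw [div_eq_div_iff (mul_ne_zero h1 h2) (by
    refine mul_ne_zero (div_ne_zero (mul_ne_zero h1 h3) hf) (div_ne_zero (mul_ne_zero h2 h4) hf))]
  field_simp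
  linear_combination -(poch (c - a) N * poch (c - b) N) * hpow

lemma one_nat (k : ℕ) : (1 : ℂ) + k ≠ 0 := by
  rw [add_comm]; exact_mod_cast k.succ_ne_zero

lemma coef_real {r : ℝ} (hr : 0 < r) (n : ℕ) :
    ((‖coef (r : ℂ) 1 1 n‖ : ℝ) : ℂ) = coef (r : ℂ) 1 1 n := by
  have h : coef (r : ℂ) 1 1 n = (((∏ j ∈ Finset.range n, (r + j)) / (n ! : ℝ) : ℝ) : ℂ) := by
    have := poch_ne_zero one_nat n
    rw [coef, mul_comm (poch 1 n), mul_div_mul_right _ _ this, poch_eq_prod]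
    push_cast
    rfl
  rw [h, Complex.norm_real, Real.norm_of_nonneg]
  positivity

lemma abelian {q : ℕ → ℂ} (hq : Good q) {s : ℂ} (hs : s.re < 0)
    (h : Tendsto (fun n : ℕ => q n * (n : ℂ) ^ (s + 1)) atTop (𝓝 0)) :
    Tendsto (fun ξ : ℝ => ((1 : ℂ) - ξ) ^ (-s) * S q ξ) (𝓝[<] 1) (𝓝 0) := by
  set σ : ℝ := s.re with hσ
  set w : ℕ → ℝ := fun n => ‖coef ((-σ : ℝ) : ℂ) 1 1 n‖ with hw
  have hgw : Good (coef ((-σ : ℝ) : ℂ) 1 1) := coef_good one_nat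
  have hsumw : ∀ ξ ∈ Set.Ioo (0 : ℝ) 1, ∑' n, w n * ξ ^ n = (1 - ξ) ^ σ := by
    intro ξ hξ
    have hb := binom ((-σ : ℝ) : ℂ) (x := ξ) (mem_U.1 (ofReal_mem_U hξ)).1
    have e1 : (1 : ℂ) - ξ = ((1 - ξ : ℝ) : ℂ) := by push_cast; ring
    have e2 : -((-σ : ℝ) : ℂ) = (σ : ℂ) := by push_cast; ring
    rw [e1, e2, ← Complex.ofReal_cpow (by linarith [hξ.2])] at hb
    apply Complex.ofReal_injective
    rw [← hb, S, Complex.ofReal_tsum]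
    congr 1; ext n
    push_cast
    rw [hw]
    simp only
    rw [coef_real (by linarith)]
    push_cast
    rfl
  have hlim : Tendsto (fun n : ℕ => w n * (n : ℝ) ^ (σ + 1)) atTop
      (𝓝 ‖Gamma 1 / (Gamma ((-σ : ℝ) : ℂ) * Gamma 1)‖) := by
    refine (coef_asymp (a := ((-σ : ℝ) : ℂ)) (b := 1) one_nat).norm.congr' ?_
    filter_upwards [eventually_gt_atTop 0] with n hn
    rw [norm_mul, Complex.norm_natCast_cpow_of_pos hn]
    congr 2
    simp
  have hGne : ‖Gamma 1 / (Gamma ((-σ : ℝ) : ℂ) * Gamma 1)‖ ≠ 0 := by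
    have : Gamma ((-σ : ℝ) : ℂ) ≠ 0 := Complex.Gamma_ne_zero_of_re_pos (by simpa using hs)
    simp [this]
    simpa using this
  have hratio : Tendsto (fun n : ℕ => ‖q n * (n : ℂ) ^ (s + 1)‖ / (w n * (n : ℝ) ^ (σ + 1)))
      atTop (𝓝 0) := by
    have := h.norm.div hlim hGne
    simpa using! this
  have hsmall : ∀ ε > 0, ∃ M : ℝ, 0 ≤ M ∧ ∀ ξ ∈ Set.Ioo (0 : ℝ) 1,
      ‖S q ξ‖ ≤ M + ε * (1 - ξ) ^ σ := by
    intro ε hε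
    have hev := (hratio.eventually (gt_mem_nhds hε)).and (eventually_gt_atTop 0)
    obtain ⟨N, hN⟩ := eventually_atTop.1 hev
    have hb : ∀ n, ‖q n‖ ≤ (if n ∈ Finset.range N then ‖q n‖ else 0) + ε * w n := by
      intro n
      by_cases hn : n < N
      · have : 0 ≤ ε * w n := by positivity
        simp [hn, this]
      · obtain ⟨h1, h2⟩ := hN n (not_lt.1 hn)
        have hn0 : (0 : ℝ) < n := by exact_mod_cast h2
        have hp : 0 < (n : ℝ) ^ (σ + 1) := Real.rpow_pos_of_pos hn0 _
        have hw0 : 0 < w n := by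
          apply norm_pos_iff.2
          have e := coef_real (r := -σ) (by linarith) n
          have hk : ∀ k : ℕ, ((-σ : ℝ) : ℂ) + k ≠ 0 := fun k hk => by
            have := congrArg Complex.re hk
            simp at this
            have := k.cast_nonneg (α := ℝ)
            linarith
          have hf : (n ! : ℂ) ≠ 0 := by exact_mod_cast n.factorial_ne_zero
          exact div_ne_zero (mul_ne_zero (poch_ne_zero hk n) (poch_ne_zero one_nat n))
            (mul_ne_zero (poch_ne_zero one_nat n) hf)
        rw [norm_mul, Complex.norm_natCast_cpow_of_pos h2, Complex.add_re, Complex.one_re,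
          mul_div_mul_right _ _ hp.ne', div_lt_iff₀ hw0] at h1
        simp [hn, h1.le]
    refine ⟨∑ n ∈ Finset.range N, ‖q n‖, by positivity, fun ξ hξ => ?_⟩
    have hx : ‖(ξ : ℂ)‖ < 1 := (mem_U.1 (ofReal_mem_U hξ)).1
    have hsq := hq.summable_norm hξ.1.le hξ.2
    have hsw : Summable fun n => w n * ξ ^ n := hgw.summable_norm hξ.1.le hξ.2
    have hfin : HasSum (fun n => if n ∈ Finset.range N then ‖q n‖ else 0)
        (∑ n ∈ Finset.range N, ‖q n‖) := by
      have : HasSum (fun n => if n ∈ Finset.range N then ‖q n‖ else 0)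
          (∑ n ∈ Finset.range N, if n ∈ Finset.range N then ‖q n‖ else 0) :=
        hasSum_sum_of_ne_finset_zero (fun n hn => if_neg hn)
      rwa [Finset.sum_congr rfl (fun n hn => if_pos hn)] at this
    have hS : ‖S q ξ‖ ≤ ∑' n, ‖q n‖ * ξ ^ n := by
      have e : (fun n => ‖q n * (ξ : ℂ) ^ n‖) = fun n => ‖q n‖ * ξ ^ n := by
        ext n
        rw [norm_mul, norm_pow, Complex.norm_real, Real.norm_of_nonneg hξ.1.le]
      rw [← e]
      exact norm_tsum_le_tsum_norm (by rw [e]; exact hsq)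
    refine hS.trans ?_
    rw [← hsumw ξ hξ, ← tsum_mul_left, ← hfin.tsum_eq,
      ← hfin.summable.tsum_add (hsw.mul_left ε)]
    refine hsq.tsum_le_tsum (fun n => ?_) (hfin.summable.add (hsw.mul_left ε))
    have hpow0 : 0 ≤ ξ ^ n := pow_nonneg hξ.1.le n
    have hpow1 : ξ ^ n ≤ 1 := pow_le_one₀ hξ.1.le hξ.2.le
    calc ‖q n‖ * ξ ^ n ≤ ((if n ∈ Finset.range N then ‖q n‖ else 0) + ε * w n) * ξ ^ n :=
          mul_le_mul_of_nonneg_right (hb n) hpow0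
      _ = (if n ∈ Finset.range N then ‖q n‖ else 0) * ξ ^ n + ε * (w n * ξ ^ n) := by ring
      _ ≤ _ := by
          gcongr
          apply mul_le_of_le_one_right _ hpow1
          split_ifs <;> simp
  rw [tendsto_zero_iff_norm_tendsto_zero]
  rw [Metric.tendsto_nhds]
  intro ε hε
  obtain ⟨M, hM, hb⟩ := hsmall (ε / 2) (by positivity)
  have T : Tendsto (fun ξ : ℝ => (1 - ξ) ^ (-σ) * M) (𝓝[<] 1) (𝓝 0) := by
    simpa using (tendsto_rpow1 (r := -σ) (by linarith)).mul_const M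
  filter_upwards [T.eventually (gt_mem_nhds (half_pos hε)), ev_Ioo] with ξ h1 hξ
  rw [Real.dist_eq, sub_zero, abs_of_nonneg (norm_nonneg _), norm_mul, norm_pow1 _ hξ]
  have hpos : (0 : ℝ) < 1 - ξ := by linarith [hξ.2]
  have hp : 0 < (1 - ξ) ^ (-σ) := Real.rpow_pos_of_pos hpos _
  have hone : (1 - ξ) ^ (-σ) * (1 - ξ) ^ σ = 1 := by
    rw [← Real.rpow_add hpos]; simp
  rw [Complex.neg_re, ← hσ]
  calc (1 - ξ) ^ (-σ) * ‖S q ξ‖ ≤ (1 - ξ) ^ (-σ) * (M + ε / 2 * (1 - ξ) ^ σ) :=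
        mul_le_mul_of_nonneg_left (hb ξ hξ) hp.le
    _ = (1 - ξ) ^ (-σ) * M + ε / 2 := by linear_combination ε / 2 * hone
    _ < ε := by linarith

lemma conn_B_of_neg {a b c A B : ℂ} (hc : NI c) (hs : NI (c - a - b)) (hre : (c - a - b).re < 0)
    (h : Conn a b c A B) : B = Gamma c * Gamma (a + b - c) / (Gamma a * Gamma b) := by
  have g : Good (coef a b c) := coef_good hc.nat
  have g0 : Good (coef (a + b - c) 1 1) := coef_good one_nat
  have g1 : Good (coef a b (a + b - c + 1)) := coef_good hs.e1.one.nat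
  have g2 : Good (coef (c - a) (c - b) (c - a - b + 1)) := coef_good hs.one.nat
  have hG : Gamma (a + b - c) ≠ 0 :=
    Complex.Gamma_ne_zero fun m h => hs.e1.nat m (by simp [h])
  set L := Gamma c * Gamma (a + b - c) / (Gamma a * Gamma b) with hL
  have hq : Tendsto (fun n : ℕ => (coef a b c n + (-L) * coef (a + b - c) 1 1 n)
      * (n : ℂ) ^ (c - a - b + 1)) atTop (𝓝 0) := by
    have h1 := coef_asymp (a := a) (b := b) hc.nat
    have h2 := coef_asymp (a := a + b - c) (b := 1) one_nat
    have h3 := h1.add (h2.const_mul (-L))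
    have e : Gamma c / (Gamma a * Gamma b) + -L * (Gamma 1 / (Gamma (a + b - c) * Gamma 1)) = 0 := by
      rw [hL, Complex.Gamma_one, mul_one, div_eq_mul_inv, div_eq_mul_inv, one_div]
      field_simp
      ring
    rw [e] at h3
    refine h3.congr fun n => ?_
    rw [show (1 : ℂ) - (a + b - c) - 1 + 1 = c - a - b + 1 by ring]
    ring
  have T := abelian (g.add (g0.cmul (-L))) hre hq
  have T2 : Tendsto (fun ξ : ℝ => ((1 : ℂ) - ξ) ^ (-(c - a - b)) * S (coef a b c) ξ)
      (𝓝[<] 1) (𝓝 L) := by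
    have T' := T.add_const L
    rw [zero_add] at T'
    refine T'.congr' ?_
    filter_upwards [ev_Ioo] with ξ hξ
    have hx := (mem_U.1 (ofReal_mem_U hξ)).1
    have h1 : (1 : ℂ) - ξ ≠ 0 := slitPlane_ne_zero (slit1 (ofReal_mem_U hξ))
    rw [S_add g (g0.cmul _) hx, S_cmul, binom _ hx, show -(a + b - c) = c - a - b by ring]
    have : ((1 : ℂ) - ξ) ^ (-(c - a - b)) * ((1 : ℂ) - ξ) ^ (c - a - b) = 1 := by
      rw [← Complex.cpow_add _ _ h1]; simp
    linear_combination -L * this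
  have T3 := (((tendsto_pow1 (s := -(c - a - b)) (by rw [Complex.neg_re]; linarith)).mul
    (tendsto_S1 g1)).const_mul A).add ((tendsto_S1 g2).const_mul B)
  simp only [coef_zero, mul_one, mul_zero, zero_add] at T3
  refine tendsto_nhds_unique T3 (T2.congr' ?_)
  filter_upwards [ev_Ioo] with ξ hξ
  have h1 : (1 : ℂ) - ξ ≠ 0 := slitPlane_ne_zero (slit1 (ofReal_mem_U hξ))
  have : ((1 : ℂ) - ξ) ^ (-(c - a - b)) * ((1 : ℂ) - ξ) ^ (c - a - b) = 1 := by
    rw [← Complex.cpow_add _ _ h1]; simp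
  rw [h _ (ofReal_mem_U hξ), u1, u2]
  linear_combination B * S (coef (c - a) (c - b) (c - a - b + 1)) (1 - ξ) * this

lemma conn_B (n : ℕ) : ∀ {a b c A B : ℂ}, NI c → NI (c - a - b) → (c - a - b).re < n →
    Conn a b c A B → B = Gamma c * Gamma (a + b - c) / (Gamma a * Gamma b) := by
  induction n with
  | zero => intro a b c A B hc hs hre h; exact conn_B_of_neg hc hs (by simpa using hre) h
  | succ n ih =>
    intro a b c A B hc hs hre h
    have hc' : NI (c - 1) := by simpa [sub_eq_add_neg] using hc.add_int (-1)
    have hs' : NI (c - 1 - a - b) := by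
      have := hs.add_int (-1)
      convert this using 1
      push_cast; ring
    have h' : Conn a b (c - 1 + 1) A B := by rwa [sub_add_cancel]
    have := ih hc' hs' (by push_cast at hre; simp at hre ⊢; linarith) (conn_shift hc' hs' h')
    have hG1 : Gamma c = (c - 1) * Gamma (c - 1) := by
      have := Complex.Gamma_add_one (c - 1) hc'.ne
      rwa [sub_add_cancel] at this
    have hG2 : Gamma (a + b - (c - 1)) = (a + b - c) * Gamma (a + b - c) := by
      rw [← Complex.Gamma_add_one _ hs.e1.ne]; congr 1; ring
    rw [hG2] at this
    rw [hG1]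
    have n1 := hc'.ne
    have n2 := hs.ne
    have e : B = -((c - 1) / (c - a - b)) * (-(c - 1 - a - b + 1) / (c - 1) * B) := by
      rw [show c - 1 - a - b + 1 = c - a - b by ring]
      field_simp
    rw [e, this, show a + b - c = -(c - a - b) by ring]
    rw [div_eq_mul_inv (_ * _) (Gamma a * Gamma b), div_eq_mul_inv (_ * _) (Gamma a * Gamma b)]
    field_simp

end HypConn

/-- the hypergeometric connection formula relating solutions at `ξ = 0`
to solutions at `ξ = 1`, for `c ∉ ℤ` and `c - a - b ∉ ℤ`. -/
theorem hypergeometric_connection_formula (a b c : ℂ)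
    (hc : ∀ k : ℤ, c ≠ (k : ℂ)) (hcab : ∀ k : ℤ, c - a - b ≠ (k : ℂ)) :
    ∀ ξ ∈ Set.Ioo (0 : ℝ) 1,
      hypF a b c (ξ : ℂ)
        = (Complex.Gamma c * Complex.Gamma (c - a - b)
              / (Complex.Gamma (c - a) * Complex.Gamma (c - b)))
            * hypF a b (a + b - c + 1) ((1 : ℂ) - ξ)
          + (Complex.Gamma c * Complex.Gamma (a + b - c)
              / (Complex.Gamma a * Complex.Gamma b))
            * ((1 : ℂ) - ξ) ^ (c - a - b)
            * hypF (c - a) (c - b) (c - a - b + 1) ((1 : ℂ) - ξ) := by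
  intro ξ hξ
  obtain ⟨A, B, h⟩ := HypConn.exists_conn (a := a) (b := b) hc hcab
  obtain ⟨n, hn⟩ := exists_nat_gt (c - a - b).re
  have hA := HypConn.conn_A hc hcab h
  have hB := HypConn.conn_B n hc hcab hn h
  have := h _ (HypConn.ofReal_mem_U hξ)
  rw [HypConn.hypF_eq, HypConn.hypF_eq, HypConn.hypF_eq, ← hA, ← hB, this, HypConn.u1,
    HypConn.u2, mul_assoc B]
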